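/- arXiv:2507.05037 — 5 statements merged into one kernel-verified Lean document; each statement's English description precedes it below -/
import Mathlib

section
/- Let q ≥ 5 be an odd prime power. For every integer k with 2q−1 ≤ k ≤ 3q−4 there exists a minimal affine blocking set of size k in the affine plane AG(2,q). -/
abbrev Pt (F : Type) [Field F] : Type :=
  {P : Submodule F (Fin 3 → F) // Module.finrank F ↥P = 1}

abbrev Ln (F : Type) [Field F] : Type :=
  {L : Submodule F (Fin 3 → F) // Module.finrank F ↥L = 2}

variable {F : Type} [Field F]

def Incid (P : Pt F) (L : Ln F) : Prop := P.1 ≤ L.1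

def IsTangent (K : Set (Pt F)) (L : Ln F) : Prop := ∃! P : Pt F, P ∈ K ∧ Incid P L

def IsSecant (K : Set (Pt F)) (L : Ln F) : Prop :=
  ∃ P Q : Pt F, P ≠ Q ∧ P ∈ K ∧ Q ∈ K ∧ Incid P L ∧ Incid Q L

def IsBlocking (B : Set (Pt F)) : Prop :=
  (∀ L : Ln F, ∃ P ∈ B, Incid P L) ∧ (∀ L : Ln F, ∃ P : Pt F, Incid P L ∧ P ∉ B)

def IsMinimalBlocking (B : Set (Pt F)) : Prop :=
  IsBlocking B ∧ ∀ B' : Set (Pt F), B' ⊂ B → ¬ IsBlocking B'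

def IsSemioval (K : Set (Pt F)) : Prop :=
  ∀ P ∈ K, ∃! L : Ln F, Incid P L ∧ IsTangent K L

def HasRInftyAt (B : Set (Pt F)) (P : Pt F) : Prop :=
  ∃ r : Ln F, Incid P r ∧ IsTangent B r ∧
    ∀ L : Ln F, Incid P L → L ≠ r → IsSecant B L

def NonConcurrent (a b c : Ln F) : Prop :=
  ¬ ∃ P : Pt F, Incid P a ∧ Incid P b ∧ Incid P c

def VertexlessTriangle (a b c : Ln F) : Set (Pt F) :=
  {P | (Incid P a ∧ ¬ Incid P b ∧ ¬ Incid P c) ∨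
       (¬ Incid P a ∧ Incid P b ∧ ¬ Incid P c) ∨
       (¬ Incid P a ∧ ¬ Incid P b ∧ Incid P c)}

def AffPts (l m : Ln F) : Set (Pt F) := {P | Incid P m ∧ ¬ Incid P l}

def IsAffBlocking (l : Ln F) (B : Set (Pt F)) : Prop :=
  (∀ P ∈ B, ¬ Incid P l) ∧ (∀ m : Ln F, m ≠ l → ∃ P ∈ B, Incid P m)

def IsMinimalAffBlocking (l : Ln F) (B : Set (Pt F)) : Prop :=
  IsAffBlocking l B ∧ ∀ B' : Set (Pt F), B' ⊂ B → ¬ IsAffBlocking l B'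

def PiProp (l : Ln F) (Pinf : Pt F) (B : Set (Pt F)) : Prop :=
  (∀ Q ∈ B, ∃ m : Ln F, m ≠ l ∧ ¬ Incid Pinf m ∧ Incid Q m ∧ IsTangent B m) ∧
  (∀ m : Ln F, m ≠ l → Incid Pinf m → ¬ (AffPts l m ⊆ B))

def PiStrong (l : Ln F) (Pinf : Pt F) (B : Set (Pt F)) : Prop :=
  (∀ Q ∈ B, ∃! m : Ln F, m ≠ l ∧ ¬ Incid Pinf m ∧ Incid Q m ∧ IsTangent B m) ∧
  (∀ m : Ln F, m ≠ l → Incid Pinf m → ¬ (AffPts l m ⊆ B))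


open Finset in
theorem core_set (F : Type) [Field F] [Fintype F] [DecidableEq F] (h2 : (2 : F) ≠ 0)
    (i : ℕ) (hi : i + 3 ≤ Fintype.card F) :
    ∃ T : Finset (F × F), T.card + i + 4 = 3 * Fintype.card F ∧
      (∀ a b c : F, (a ≠ 0 ∨ b ≠ 0) → ∃ p ∈ T, a * p.1 + b * p.2 + c = 0) ∧
      (∀ p ∈ T, ∃ a b c : F, (a ≠ 0 ∨ b ≠ 0) ∧ a * p.1 + b * p.2 + c = 0 ∧
        ∀ p' ∈ T, a * p'.1 + b * p'.2 + c = 0 → p' = p) := by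
  obtain ⟨N, hN0, hN1, hNc, hNh⟩ : ∃ N : Finset F, (0 : F) ∉ N ∧ (1 : F) ∉ N ∧ N.card = i ∧
      (N.Nonempty → (2 : F)⁻¹ ∈ N) := by
    rcases Nat.eq_zero_or_pos i with h | h
    · exact ⟨∅, by simp [h]⟩
    · have h21 : (2 : F)⁻¹ ≠ 1 := by
        intro h
        have h3 : (2 : F) = 1 := inv_eq_one.mp h
        have : (1 : F) = 0 := by linear_combination h3
        exact one_ne_zero this
      have hsub : ({(2 : F)⁻¹} : Finset F) ⊆ univ \ {0, 1} := by
        intro x hx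
        simp only [Finset.mem_singleton] at hx
        subst hx
        simp [h2, h21]
      have hc : (univ \ {0, 1} : Finset F).card = Fintype.card F - 2 := by
        rw [Finset.card_sdiff_of_subset (Finset.subset_univ _), Finset.card_univ,
          Finset.card_pair zero_ne_one]
      obtain ⟨N, h1, h3, h4⟩ := Finset.exists_subsuperset_card_eq hsub (n := i)
        (by rw [Finset.card_singleton]; exact h) (by rw [hc]; omega)
      refine ⟨N, fun h => by have := h3 h; simp at this, fun h => by have := h3 h; simp at this, h4,
        fun _ => h1 (by simp)⟩
  set N' : Finset F := N.image (fun y => y⁻¹ - 1) with hN'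
  have hinj : Function.Injective (fun y : F => y⁻¹ - 1) := by
    intro a b h
    simpa using h
  have hN'c : N'.card = i := by rw [hN', Finset.card_image_of_injective _ hinj, hNc]
  have hN'0 : (0 : F) ∉ N' := by
    simp only [hN', Finset.mem_image, not_exists, not_and]
    intro y hy h
    have : y⁻¹ = 1 := by linear_combination h
    rw [inv_eq_one] at this
    exact hN1 (this ▸ hy)
  have hN'm : (-1 : F) ∉ N' := by
    simp only [hN', Finset.mem_image, not_exists, not_and]
    intro y hy h
    have : y⁻¹ = 0 := by linear_combination h
    rw [inv_eq_zero] at this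
    exact hN0 (this ▸ hy)
  let A : Finset F := univ \ insert 0 N'
  let C : Finset F := univ \ insert 0 (insert 1 N)
  have hA : ∀ x, x ∈ A ↔ x ≠ 0 ∧ x ∉ N' := by intro x; simp [A]
  have hC : ∀ x, x ∈ C ↔ x ≠ 0 ∧ x ≠ 1 ∧ x ∉ N := by intro x; simp [C]
  have hAc : A.card + i + 1 = Fintype.card F := by
    have := Finset.card_sdiff_add_card_eq_card (Finset.subset_univ (insert 0 N'))
    rw [Finset.card_insert_of_notMem hN'0, Finset.card_univ] at this
    simp only [A]; omega
  have hCc : C.card + i + 2 = Fintype.card F := by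
    have := Finset.card_sdiff_add_card_eq_card (Finset.subset_univ (insert 0 (insert 1 N)))
    rw [Finset.card_insert_of_notMem (by simp [hN0]), Finset.card_insert_of_notMem hN1,
      Finset.card_univ] at this
    simp only [C]; omega
  clear_value A C
  let T1 : Finset (F × F) := (univ.erase (0 : F)).image (fun a => (a, 0))
  let T2 : Finset (F × F) := A.image (fun a => (a, 1))
  let T3 : Finset (F × F) := C.image (fun y => (0, y))
  let T4 : Finset (F × F) := N.image (fun y => (1 - y, y))
  have m1 : ∀ p, p ∈ T1 ↔ p.1 ≠ 0 ∧ p.2 = 0 := by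
    rintro ⟨x, y⟩; simp [T1]; tauto
  have m2 : ∀ p, p ∈ T2 ↔ p.1 ∈ A ∧ p.2 = 1 := by
    rintro ⟨x, y⟩; simp [T2]; tauto
  have m3 : ∀ p, p ∈ T3 ↔ p.1 = 0 ∧ p.2 ∈ C := by
    rintro ⟨x, y⟩; simp [T3]; tauto
  have m4 : ∀ p, p ∈ T4 ↔ p.2 ∈ N ∧ p.1 = 1 - p.2 := by
    rintro ⟨x, y⟩; simp [T4]; grind
  have c1 : T1.card + 1 = Fintype.card F := by
    rw [Finset.card_image_of_injective _ (fun a b h => by simpa using h)]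
    simp [Finset.card_erase_of_mem]; omega
  have c2 : T2.card = A.card := Finset.card_image_of_injective _ (fun a b h => by simpa using h)
  have c3 : T3.card = C.card := Finset.card_image_of_injective _ (fun a b h => by simpa using h)
  have c4 : T4.card = i := by
    rw [← hNc]; exact Finset.card_image_of_injective _ (fun a b h => by simpa using (Prod.ext_iff.mp h).2)
  have mT : ∀ p, p ∈ T1 ∪ (T2 ∪ (T3 ∪ T4)) ↔ (p.1 ≠ 0 ∧ p.2 = 0) ∨ (p.1 ∈ A ∧ p.2 = 1) ∨
      (p.1 = 0 ∧ p.2 ∈ C) ∨ (p.2 ∈ N ∧ p.1 = 1 - p.2) := by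
    intro p; simp only [Finset.mem_union, m1, m2, m3, m4]
  clear_value T1 T2 T3 T4
  refine ⟨T1 ∪ (T2 ∪ (T3 ∪ T4)), ?_, ?_, ?_⟩
  · rw [Finset.card_union_of_disjoint, Finset.card_union_of_disjoint,
      Finset.card_union_of_disjoint]
    · omega
    · rw [Finset.disjoint_left]; intro p; rw [m3, m4, hC]; tauto
    · rw [Finset.disjoint_left]; intro p; rw [Finset.mem_union, m2, m3, m4, hC]
      rintro ⟨-, h⟩; rw [h]; tauto
    · rw [Finset.disjoint_left]; intro p
      rw [Finset.mem_union, Finset.mem_union, m1, m2, m3, m4, hC]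
      rintro ⟨-, h⟩; rw [h]; simp [hN0]
  · intro a b c hab
    by_cases ha : a = 0
    · have hb : b ≠ 0 := by tauto
      have key : ∀ x y, y = -c / b → a * x + b * y + c = 0 := by
        intro x y h; rw [h, ha]; field_simp; ring
      by_cases h0 : -c / b = 0
      · exact ⟨(1, 0), by rw [mT]; simp, key _ _ h0.symm⟩
      by_cases h1 : -c / b = 1
      · exact ⟨(-1, 1), by rw [mT, hA]; simp [hN'm], key _ _ h1.symm⟩
      by_cases h3 : -c / b ∈ N
      · exact ⟨(1 - (-c / b), -c / b), (mT _).mpr (Or.inr (Or.inr (Or.inr ⟨h3, rfl⟩))), key _ _ rfl⟩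
      · exact ⟨(0, -c / b), (mT _).mpr (Or.inr (Or.inr (Or.inl ⟨rfl, (hC _).mpr ⟨h0, h1, h3⟩⟩))), key _ _ rfl⟩
    · by_cases hc : c = 0
      · subst hc
        have key : ∀ x y, x = (-b / a) * y → a * x + b * y + 0 = 0 := by
          intro x y h; rw [h]; field_simp; ring
        generalize -b / a = t at key
        by_cases h0 : t = 0
        · have : C.Nonempty := by rw [← Finset.card_pos]; omega
          obtain ⟨y, hy⟩ := this
          exact ⟨(0, y), (mT _).mpr (Or.inr (Or.inr (Or.inl ⟨rfl, hy⟩))), key _ _ (by simp [h0])⟩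
        by_cases h1 : t ∈ N'
        · obtain ⟨y, hy, rfl⟩ := Finset.mem_image.mp h1
          have hy0 : y ≠ 0 := fun h => hN0 (h ▸ hy)
          exact ⟨(1 - y, y), (mT _).mpr (Or.inr (Or.inr (Or.inr ⟨hy, rfl⟩))), key _ _ (by field_simp)⟩
        · exact ⟨(t, 1), (mT _).mpr (Or.inr (Or.inl ⟨(hA _).mpr ⟨h0, h1⟩, rfl⟩)), key _ _ (by simp)⟩
      · exact ⟨(-c / a, 0), by rw [mT]; simp [ha, hc], by field_simp; ring⟩
  · rintro ⟨x, y⟩ hp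
    rw [mT] at hp
    simp only at hp
    rcases hp with ⟨hx, rfl⟩ | ⟨hx, rfl⟩ | ⟨rfl, hy⟩ | ⟨hy, rfl⟩
    · by_cases hs : x = 1 ∧ N.Nonempty
      · obtain ⟨rfl, hne⟩ := hs
        have h12 : (1 : F) ∈ N' := Finset.mem_image.mpr ⟨2⁻¹, hNh hne, by
          simp only [inv_inv]; ring⟩
        refine ⟨1, 0, -1, by simp, by simp, ?_⟩
        rintro ⟨x', y'⟩ hp' he
        simp only at he
        have hx' : x' = 1 := by linear_combination he
        subst hx'
        rw [mT, hA] at hp'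
        simp only at hp'
        rcases hp' with h | h | h | h
        · rw [h.2]
        · exact absurd h12 h.1.2
        · exact absurd h.1 one_ne_zero
        · have : y' = 0 := by linear_combination h.2
          exact absurd (this ▸ h.1) hN0
      · refine ⟨1, x, -x, by simp, by ring, ?_⟩
        rintro ⟨x', y'⟩ hp' he
        rw [mT, hA, hC] at hp'
        simp only at hp' he
        rcases hp' with h | h | h | h
        · have : x' = x := by rw [h.2] at he; linear_combination he
          rw [h.2, this]
        · have : x' = 0 := by rw [h.2] at he; linear_combination he
          exact absurd this h.1.1
        · rw [h.1] at he
          have : x * (y' - 1) = 0 := by linear_combination he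
          rcases mul_eq_zero.mp this with h' | h'
          · exact absurd h' hx
          · exact absurd (sub_eq_zero.mp h') h.2.2.1
        · rw [h.2] at he
          have : (x - 1) * (y' - 1) = 0 := by linear_combination he
          rcases mul_eq_zero.mp this with h' | h'
          · exact absurd ⟨sub_eq_zero.mp h', ⟨y', h.1⟩⟩ hs
          · exact absurd ((sub_eq_zero.mp h') ▸ h.1) hN1
    · refine ⟨1, -x, 0, by simp, by ring, ?_⟩
      rw [hA] at hx
      rintro ⟨x', y'⟩ hp' he
      rw [mT, hA, hC] at hp'
      simp only at hp' he
      have he' : x' = x * y' := by linear_combination he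
      rcases hp' with h | h | h | h
      · rw [h.2] at he'; exact absurd (by simpa using he') h.1
      · rw [h.2] at he' ⊢; rw [he']; simp
      · rw [h.1] at he'
        rcases mul_eq_zero.mp he'.symm with h' | h'
        · exact absurd h' hx.1
        · exact absurd h' h.2.1
      · have hy0 : y' ≠ 0 := fun h0 => hN0 (h0 ▸ h.1)
        refine absurd (Finset.mem_image.mpr ⟨y', h.1, ?_⟩) hx.2
        rw [h.2] at he'
        field_simp
        exact he'.trans (mul_comm _ _)
    · rw [hC] at hy
      refine ⟨0, 1, -y, by simp, by ring, ?_⟩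
      rintro ⟨x', y'⟩ hp' he
      rw [mT] at hp'
      simp only at hp' he
      have he' : y' = y := by linear_combination he
      subst he'
      rcases hp' with h | h | h | h
      · exact absurd h.2 hy.1
      · exact absurd h.2 hy.2.1
      · rw [h.1]
      · exact absurd h.1 hy.2.2
    · refine ⟨0, 1, -y, by simp, by ring, ?_⟩
      rintro ⟨x', y'⟩ hp' he
      rw [mT, hC] at hp'
      simp only at hp' he
      have he' : y' = y := by linear_combination he
      subst he'
      rcases hp' with h | h | h | h
      · exact absurd (h.2 ▸ hy) hN0
      · exact absurd (h.2 ▸ hy) hN1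
      · exact absurd hy h.2.2.2
      · rw [h.2]

theorem coords_exist (F : Type) [Field F] (l : Ln F) :
    ∃ e : (Fin 3 → F) ≃ₗ[F] (F × F) × F, ∀ v, v ∈ l.1 ↔ (e v).2 = 0 := by
  obtain ⟨l', hl'⟩ := Submodule.exists_isCompl l.1
  have h1 : Module.finrank F l' = 1 := by
    have := Submodule.finrank_add_eq_of_isCompl hl'
    rw [l.2] at this
    simp at this
    omega
  let f1 : l.1 ≃ₗ[F] F × F := LinearEquiv.ofFinrankEq _ _ (by rw [l.2]; simp)
  let f2 : l' ≃ₗ[F] F := LinearEquiv.ofFinrankEq _ _ (by rw [h1]; simp)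
  refine ⟨(Submodule.prodEquivOfIsCompl _ _ hl').symm.trans (f1.prodCongr f2), fun v => ?_⟩
  simp [LinearEquiv.prodCongr_apply]

theorem finrank_ker_two (F : Type) [Field F] (f : (Fin 3 → F) →ₗ[F] F) (hf : f ≠ 0) :
    Module.finrank F (LinearMap.ker f) = 2 := by
  have h := LinearMap.finrank_range_add_finrank_ker f
  rw [LinearMap.range_eq_top.mpr (LinearMap.surjective hf)] at h
  simp at h
  omega

/-- For odd `q ≥ 5` and every `2q-1 ≤ k ≤ 3q-4` there is a minimal affine blocking set
of size `k` in AG(2,q). -/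
theorem exists_minimalAffBlocking_odd
    (F : Type) [Field F] [Fintype F] (hq : 5 ≤ Fintype.card F)
    (hodd : Odd (Fintype.card F))
    (l : Ln F) (k : ℕ)
    (hk1 : 2 * Fintype.card F - 1 ≤ k) (hk2 : k ≤ 3 * Fintype.card F - 4) :
    ∃ B : Set (Pt F), IsMinimalAffBlocking l B ∧ B.ncard = k := by
  classical
  have h2 : (2 : F) ≠ 0 := by
    intro h
    have hc : ringChar F = 2 := by
      have hd : ringChar F ∣ 2 := (ringChar.spec F 2).mp (by exact_mod_cast h)
      rcases (Nat.dvd_prime Nat.prime_two).mp hd with h1 | h1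
      · exact absurd h1 CharP.ringChar_ne_one
      · exact h1
    have := FiniteField.even_card_of_char_two hc
    rw [Nat.odd_iff] at hodd
    omega
  obtain ⟨T, hTc, hTb, hTt⟩ := core_set F h2 (3 * Fintype.card F - 4 - k) (by omega)
  have hTk : T.card = k := by omega
  obtain ⟨e, he⟩ := coords_exist F l
  let w : F × F → (Fin 3 → F) := fun p => e.symm (p, 1)
  have hw0 : ∀ p, w p ≠ 0 := by
    intro p h
    have : (p, (1 : F)) = 0 := by simpa [w] using h
    exact one_ne_zero (congrArg Prod.snd this)
  let pt : F × F → Pt F := fun p => ⟨Submodule.span F {w p}, finrank_span_singleton (hw0 p)⟩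
  have hinc : ∀ p (m : Ln F), Incid (pt p) m ↔ w p ∈ m.1 := by
    intro p m
    simp [Incid, pt, Submodule.span_le]
  have hinj : Function.Injective pt := by
    intro p p' h
    have h1 : w p ∈ Submodule.span F {w p'} := by
      have h0 : Submodule.span F {w p} = Submodule.span F {w p'} := congrArg Subtype.val h
      rw [← h0]
      exact Submodule.mem_span_singleton_self _
    obtain ⟨c, hc⟩ := Submodule.mem_span_singleton.mp h1
    have h3 : c • (p', (1 : F)) = (p, 1) := by
      apply e.symm.injective
      rw [map_smul]; exact hc
    have h4 : c = 1 := by simpa using congrArg Prod.snd h3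
    subst h4
    simpa using (congrArg Prod.fst h3).symm
  have hvec : ∀ (f : (Fin 3 → F) →ₗ[F] F) (p : F × F) (z : F), f (e.symm (p, z)) =
      f (e.symm ((1, 0), 0)) * p.1 + f (e.symm ((0, 1), 0)) * p.2 +
      f (e.symm ((0, 0), 1)) * z := by
    intro f p z
    have : (p, z) = p.1 • (((1, 0), 0) : (F × F) × F) + p.2 • (((0, 1), 0) : (F × F) × F) +
        z • (((0, 0), 1) : (F × F) × F) := by
      ext <;> simp
    rw [this]
    simp only [map_add, map_smul, smul_eq_mul]
    ring
  have hline : ∀ m : Ln F, m ≠ l → ∃ a b c : F, (a ≠ 0 ∨ b ≠ 0) ∧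
      ∀ p, Incid (pt p) m ↔ a * p.1 + b * p.2 + c = 0 := by
    intro m hm
    have hlt : m.1 < ⊤ := by
      rw [lt_top_iff_ne_top]
      intro h
      have := m.2
      rw [h] at this
      simp at this
    obtain ⟨f, hf0, hf⟩ := Submodule.exists_le_ker_of_lt_top m.1 hlt
    have hmf : m.1 = LinearMap.ker f :=
      Submodule.eq_of_le_of_finrank_eq hf (by rw [m.2, finrank_ker_two F f hf0])
    refine ⟨f (e.symm ((1, 0), 0)), f (e.symm ((0, 1), 0)), f (e.symm ((0, 0), 1)), ?_, ?_⟩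
    · by_contra! hcon
      apply hm
      apply Subtype.ext
      refine (Submodule.eq_of_le_of_finrank_eq ?_ (by rw [m.2, l.2])).symm
      intro v hv
      rw [he] at hv
      rw [hmf, LinearMap.mem_ker]
      have := hvec f (e v).1 (e v).2
      rw [Prod.mk.eta, e.symm_apply_apply, hcon.1, hcon.2, hv] at this
      simpa using this
    · intro p
      rw [hinc, hmf, LinearMap.mem_ker, hvec, mul_one]
  have hline' : ∀ a b c : F, (a ≠ 0 ∨ b ≠ 0) → ∃ m : Ln F, m ≠ l ∧
      ∀ p, Incid (pt p) m ↔ a * p.1 + b * p.2 + c = 0 := by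
    intro a b c hab
    let f : (Fin 3 → F) →ₗ[F] F :=
      (a • (LinearMap.fst F F F ∘ₗ LinearMap.fst F (F × F) F) +
        b • (LinearMap.snd F F F ∘ₗ LinearMap.fst F (F × F) F) +
        c • LinearMap.snd F (F × F) F) ∘ₗ e.toLinearMap
    have hfv : ∀ p z, f (e.symm (p, z)) = a * p.1 + b * p.2 + c * z := by
      intro p z; simp [f]
    have hex : ∃ p : F × F, f (e.symm (p, 0)) ≠ 0 := by
      rcases hab with h | h
      · exact ⟨(1, 0), by simpa [hfv] using h⟩
      · exact ⟨(0, 1), by simpa [hfv] using h⟩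
    obtain ⟨p0, hp0⟩ := hex
    have hf0 : f ≠ 0 := by
      intro h; rw [h] at hp0; exact hp0 rfl
    refine ⟨⟨LinearMap.ker f, finrank_ker_two F f hf0⟩, ?_, ?_⟩
    · intro h
      have h1 : e.symm (p0, 0) ∈ l.1 := by rw [he]; simp
      rw [← h] at h1
      exact hp0 h1
    · intro p
      rw [hinc]
      change f (e.symm (p, 1)) = 0 ↔ _
      rw [hfv, mul_one]
  refine ⟨pt '' (T : Set (F × F)), ⟨⟨?_, ?_⟩, ?_⟩, ?_⟩
  · rintro _ ⟨p, -, rfl⟩ h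
    rw [hinc, he] at h
    simp [w] at h
  · intro m hm
    obtain ⟨a, b, c, hab, h⟩ := hline m hm
    obtain ⟨p, hp, hpe⟩ := hTb a b c hab
    exact ⟨pt p, ⟨p, hp, rfl⟩, (h p).mpr hpe⟩
  · rintro B' hB' ⟨-, hbl⟩
    obtain ⟨hsub, hns⟩ := hB'
    apply hns
    rintro _ ⟨p, hp, rfl⟩
    obtain ⟨a, b, c, hab, -, hu⟩ := hTt p hp
    obtain ⟨m, hm, h⟩ := hline' a b c hab
    obtain ⟨Q, hQ, hQm⟩ := hbl m hm
    obtain ⟨p', hp', rfl⟩ := hsub hQ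
    rw [← hu p' hp' ((h p').mp hQm)]
    exact hQ
  · rw [Set.ncard_image_of_injective _ hinj, Set.ncard_coe_finset, hTk]
end

section
/- Fix a line ℓ of PG(2,q) and a point P ∈ ℓ. Let X_{P,ℓ} be the collection of all minimal blocking sets 𝓑 of PG(2,q) having the r∞-property with respect to P whose unique tangent line through P is ℓ, and let Y_{Π_P} be the collection of all minimal affine blocking sets of AG(2,q) = PG(2,q) \ ℓ having the Π-property with respect to the direction Π_P. Then the map α defined by α(𝓑) = 𝓑 \ {P} is a well-defined bijection from X_{P,ℓ} onto Y_{Π_P}. -/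
variable {F : Type} [Field F]

lemma exists_inter (l m : Ln F) : ∃ R : Pt F, Incid R l ∧ Incid R m := by
  have h1 := Submodule.finrank_sup_add_finrank_inf_eq l.1 m.1
  have h2 : Module.finrank F ↥(l.1 ⊔ m.1) ≤ 3 := by
    simpa using Submodule.finrank_le (l.1 ⊔ m.1)
  rw [l.2, m.2] at h1
  have h3 : l.1 ⊓ m.1 ≠ ⊥ := by
    intro h
    rw [h, finrank_bot] at h1
    omega
  obtain ⟨v, hv, hv0⟩ := Submodule.exists_mem_ne_zero_of_ne_bot h3
  refine ⟨⟨Submodule.span F {v}, finrank_span_singleton hv0⟩, ?_, ?_⟩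
  · exact (Submodule.span_singleton_le_iff_mem _ _).2 hv.1
  · exact (Submodule.span_singleton_le_iff_mem _ _).2 hv.2

lemma line_eq_of_two {l m : Ln F} {P Q : Pt F} (hPQ : P ≠ Q) (h1 : Incid P l) (h2 : Incid P m)
    (h3 : Incid Q l) (h4 : Incid Q m) : m = l := by
  have hs := Submodule.finrank_sup_add_finrank_inf_eq P.1 Q.1
  rw [P.2, Q.2] at hs
  have hle : Module.finrank F ↥(P.1 ⊓ Q.1) ≠ 1 := by
    intro h
    apply hPQ
    apply Subtype.ext
    have e1 : P.1 ⊓ Q.1 = P.1 :=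
      Submodule.eq_of_le_of_finrank_eq inf_le_left (by rw [h, P.2])
    have e2 : P.1 ⊓ Q.1 = Q.1 :=
      Submodule.eq_of_le_of_finrank_eq inf_le_right (by rw [h, Q.2])
    exact e1.symm.trans e2
  have hle' : Module.finrank F ↥(P.1 ⊓ Q.1) ≤ 1 := by
    have := Submodule.finrank_mono (inf_le_left : P.1 ⊓ Q.1 ≤ P.1)
    rwa [P.2] at this
  have hr : Module.finrank F ↥(P.1 ⊔ Q.1) = 2 := by omega
  have a : P.1 ⊔ Q.1 = l.1 :=
    Submodule.eq_of_le_of_finrank_eq (sup_le h1 h3) (by rw [hr, l.2])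
  have b : P.1 ⊔ Q.1 = m.1 :=
    Submodule.eq_of_le_of_finrank_eq (sup_le h2 h4) (by rw [hr, m.2])
  exact Subtype.ext (b.symm.trans a)

lemma exists_other (l : Ln F) (P : Pt F) : ∃ R : Pt F, Incid R l ∧ R ≠ P := by
  have h : ¬ l.1 ≤ P.1 := by
    intro h
    have := Submodule.finrank_mono h
    rw [l.2, P.2] at this
    omega
  obtain ⟨v, hv, hvP⟩ := SetLike.not_le_iff_exists.1 h
  have hv0 : v ≠ 0 := by
    rintro rfl
    exact hvP (zero_mem _)
  refine ⟨⟨Submodule.span F {v}, finrank_span_singleton hv0⟩,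
    (Submodule.span_singleton_le_iff_mem _ _).2 hv, ?_⟩
  rintro rfl
  exact hvP (Submodule.mem_span_singleton_self v)

lemma minimal_tangent {B : Set (Pt F)} (hB : IsMinimalBlocking B) {Q : Pt F} (hQ : Q ∈ B) :
    ∃ L : Ln F, Incid Q L ∧ ∀ R ∈ B, Incid R L → R = Q := by
  have h := hB.2 (B \ {Q}) ⟨Set.diff_subset, fun h => (h hQ).2 rfl⟩
  have h' : ¬ ∀ L : Ln F, ∃ R ∈ B \ {Q}, Incid R L := by
    intro h1
    refine h ⟨h1, fun L => ?_⟩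
    obtain ⟨R, hR, hRB⟩ := hB.1.2 L
    exact ⟨R, hR, fun h => hRB h.1⟩
  push Not at h'
  obtain ⟨L, hL⟩ := h'
  have key : ∀ R ∈ B, Incid R L → R = Q := by
    intro R hR hRL
    by_contra hne
    exact hL R ⟨hR, hne⟩ hRL
  obtain ⟨R, hR, hRL⟩ := hB.1.1 L
  have := key R hR hRL
  subst this
  exact ⟨L, hRL, key⟩

/-- The map `B ↦ B \ {P}` is a bijection from the minimal blocking sets of PG(2,q) with
the r∞-property with respect to `P` with unique tangent `l` through `P`, onto the
minimal affine blocking sets of AG(2,q) = PG(2,q) \ l with the Π-property with respect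
to the direction `Π_P`. -/
theorem bijOn_minimalBlocking_rInfty_minimalAffBlocking_piProp
    (F : Type) [Field F] [Fintype F] (l : Ln F) (P : Pt F) (hPl : Incid P l) :
    Set.BijOn (fun B : Set (Pt F) => B \ {P})
      {B : Set (Pt F) | IsMinimalBlocking B ∧ P ∈ B ∧ IsTangent B l ∧
        ∀ L : Ln F, Incid P L → L ≠ l → IsSecant B L}
      {B' : Set (Pt F) | IsMinimalAffBlocking l B' ∧ PiProp l P B'} := by
  refine ⟨?_, ?_, ?_⟩
  · rintro B ⟨hB, hPB, hT, hS⟩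
    have hl : ∀ R ∈ B, Incid R l → R = P := fun R hR hRl => hT.unique ⟨hR, hRl⟩ ⟨hPB, hPl⟩
    have htan : ∀ Q ∈ B \ {P}, ∃ m : Ln F, m ≠ l ∧ ¬ Incid P m ∧ Incid Q m ∧
        ∀ R ∈ B, Incid R m → R = Q := by
      rintro Q ⟨hQ, hQP⟩
      obtain ⟨L, hQL, hL⟩ := minimal_tangent hB hQ
      have hPL : ¬ Incid P L := fun h => hQP (hL P hPB h).symm
      exact ⟨L, fun h => hPL (h ▸ hPl), hPL, hQL, hL⟩
    refine ⟨⟨⟨?_, ?_⟩, ?_⟩, ?_, ?_⟩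
    · rintro Q ⟨hQ, hQP⟩ h
      exact hQP (hl Q hQ h)
    · intro m hm
      by_cases hPm : Incid P m
      · obtain ⟨R, S, hRS, hR, hS, hRm, hSm⟩ := hS m hPm hm
        by_cases hRP : R = P
        · exact ⟨S, ⟨hS, fun h => hRS (hRP.trans (Eq.symm h))⟩, hSm⟩
        · exact ⟨R, ⟨hR, hRP⟩, hRm⟩
      · obtain ⟨R, hR, hRm⟩ := hB.1.1 m
        refine ⟨R, ⟨hR, ?_⟩, hRm⟩
        rintro rfl
        exact hPm hRm
    · intro B' hB' hb
      obtain ⟨Q, hQ, hQB'⟩ := Set.exists_of_ssubset hB'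
      obtain ⟨m, hml, hPm, hQm, hm⟩ := htan Q hQ
      obtain ⟨R, hR, hRm⟩ := hb.2 m hml
      exact hQB' (hm R (hB'.1 hR).1 hRm ▸ hR)
    · intro Q hQ
      obtain ⟨m, hml, hPm, hQm, hm⟩ := htan Q hQ
      exact ⟨m, hml, hPm, hQm, Q, ⟨hQ, hQm⟩, fun R hR => hm R hR.1.1 hR.2⟩
    · intro m hml hPm hsub
      obtain ⟨R, hRm, hRB⟩ := hB.1.2 m
      by_cases hRl : Incid R l
      · have hne : P ≠ R := fun h => hRB (h ▸ hPB)
        exact hml (line_eq_of_two hne hPl hPm hRl hRm)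
      · exact hRB (hsub ⟨hRm, hRl⟩).1
  · rintro B ⟨-, hPB, -⟩ C ⟨-, hPC, -⟩ h
    have h : B \ {P} = C \ {P} := h
    rw [← Set.insert_diff_self_of_mem hPB, h, Set.insert_diff_self_of_mem hPC]
  · rintro B ⟨⟨⟨haff, hbl⟩, -⟩, hj, hjj⟩
    have hPB : P ∉ B := fun h => haff P h hPl
    have hlP : ∀ R ∈ insert P B, Incid R l → R = P := by
      rintro R (h | h) hRl
      · exact h
      · exact absurd hRl (haff R h)
    refine ⟨insert P B, ⟨⟨⟨?_, ?_⟩, ?_⟩, Set.mem_insert _ _, ?_, ?_⟩, ?_⟩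
    · intro L
      by_cases hL : L = l
      · exact ⟨P, Set.mem_insert _ _, hL ▸ hPl⟩
      · obtain ⟨R, hR, hRL⟩ := hbl L hL
        exact ⟨R, Or.inr hR, hRL⟩
    · intro L
      by_cases hL : L = l
      · obtain ⟨R, hRl, hRP⟩ := exists_other l P
        exact ⟨R, hL ▸ hRl, fun h => hRP (hlP R h hRl)⟩
      · by_cases hPL : Incid P L
        · obtain ⟨R, hR, hRB⟩ := Set.not_subset.1 (hjj L hL hPL)
          refine ⟨R, hR.1, ?_⟩
          rintro (h | h)
          · exact hR.2 (h ▸ hPl)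
          · exact hRB h
        · obtain ⟨R, hRl, hRL⟩ := exists_inter l L
          exact ⟨R, hRL, fun h => hPL (hlP R h hRl ▸ hRL)⟩
    · intro B' hB' hb
      obtain ⟨Q, hQ, hQB'⟩ := Set.exists_of_ssubset hB'
      rcases hQ with rfl | hQ
      · obtain ⟨R, hR, hRl⟩ := hb.1 l
        exact hQB' (hlP R (hB'.1 hR) hRl ▸ hR)
      · obtain ⟨m, hml, hPm, hQm, hm⟩ := hj Q hQ
        obtain ⟨R, hR, hRm⟩ := hb.1 m
        rcases hB'.1 hR with h | h
        · exact hPm (h ▸ hRm)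
        · exact hQB' (hm.unique ⟨h, hRm⟩ ⟨hQ, hQm⟩ ▸ hR)
    · exact ⟨P, ⟨Set.mem_insert _ _, hPl⟩, fun R hR => hlP R hR.1 hR.2⟩
    · intro L hPL hL
      obtain ⟨R, hR, hRL⟩ := hbl L hL
      exact ⟨P, R, fun h => hPB (h ▸ hR), Set.mem_insert _ _, Or.inr hR, hPL, hRL⟩
    · ext R
      simp only [Set.mem_diff, Set.mem_insert_iff, Set.mem_singleton_iff]
      constructor
      · rintro ⟨h | h, h'⟩
        · exact absurd h h'
        · exact h
      · intro h
        exact ⟨Or.inr h, fun h' => hPB (h' ▸ h)⟩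
end

section
/- Let q ≥ 3 be a prime power, let a and b be two parallel affine lines of AG(2,q) and let c be an affine line not parallel to a and b; set A = b∩c and B = a∩c. Then 𝓑 = (a ∪ b ∪ c) \ {A, B} is a minimal affine blocking set of AG(2,q) of size 3q−4 which has the Π-strong property (conditions (j') and (jj)) with respect to the direction Π_c; moreover every line of Π_c other than c is a secant to 𝓑. -/
variable {F : Type} [Field F]

def mkPt (v : Fin 3 → F) (hv : v ≠ 0) : Pt F := ⟨Submodule.span F {v}, finrank_span_singleton hv⟩

theorem incid_mk (v : Fin 3 → F) (hv : v ≠ 0) (L : Ln F) : Incid (mkPt v hv) L ↔ v ∈ L.1 := by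
  simp [Incid, mkPt, Submodule.span_singleton_le_iff_mem]

theorem exists_mk (P : Pt F) : ∃ v, ∃ hv : v ≠ 0, P = mkPt v hv := by
  obtain ⟨P, hP⟩ := P
  obtain ⟨v, hv, h⟩ := finrank_eq_one_iff'.1 hP
  have hv0 : (v : Fin 3 → F) ≠ 0 := by simpa using hv
  refine ⟨v, hv0, ?_⟩
  apply Subtype.ext
  apply le_antisymm
  · intro w hw
    obtain ⟨c, hc⟩ := h ⟨w, hw⟩
    exact Submodule.mem_span_singleton.2 ⟨c, by simpa using congrArg Subtype.val hc⟩
  · exact (Submodule.span_singleton_le_iff_mem _ _).2 v.2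

theorem sup_fin (P Q : Pt F) (h : P ≠ Q) : Module.finrank F ↥(P.1 ⊔ Q.1) = 2 := by
  have h1 := Submodule.finrank_sup_add_finrank_inf_eq P.1 Q.1
  rw [P.2, Q.2] at h1
  have h2 : Module.finrank F ↥(P.1 ⊓ Q.1) ≠ 1 := by
    intro h3
    have e1 : P.1 ⊓ Q.1 = P.1 := Submodule.eq_of_le_of_finrank_eq inf_le_left (by rw [h3, P.2])
    have e2 : P.1 ⊓ Q.1 = Q.1 := Submodule.eq_of_le_of_finrank_eq inf_le_right (by rw [h3, Q.2])
    exact h (Subtype.ext (e1.symm.trans e2))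
  have h3 : Module.finrank F ↥(P.1 ⊓ Q.1) ≤ 1 := by
    have := Submodule.finrank_mono (inf_le_left : P.1 ⊓ Q.1 ≤ P.1)
    rwa [P.2] at this
  omega

theorem join_ex (P Q : Pt F) (h : P ≠ Q) : ∃ L : Ln F, Incid P L ∧ Incid Q L :=
  ⟨⟨P.1 ⊔ Q.1, sup_fin P Q h⟩, le_sup_left (a := P.1), le_sup_right (a := P.1)⟩

theorem join_uniq (P Q : Pt F) (L M : Ln F) (h : P ≠ Q) (h1 : Incid P L) (h2 : Incid Q L)
    (h3 : Incid P M) (h4 : Incid Q M) : L = M := by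
  have e1 : P.1 ⊔ Q.1 = L.1 :=
    Submodule.eq_of_le_of_finrank_eq (sup_le h1 h2) (by rw [sup_fin P Q h, L.2])
  have e2 : P.1 ⊔ Q.1 = M.1 :=
    Submodule.eq_of_le_of_finrank_eq (sup_le h3 h4) (by rw [sup_fin P Q h, M.2])
  exact Subtype.ext (e1.symm.trans e2)

theorem meet_ex (L M : Ln F) : ∃ P : Pt F, Incid P L ∧ Incid P M := by
  have h1 := Submodule.finrank_sup_add_finrank_inf_eq L.1 M.1
  have h2 := Submodule.finrank_le (L.1 ⊔ M.1)
  rw [L.2, M.2] at h1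
  simp only [Module.finrank_fin_fun] at h2
  have h3 : L.1 ⊓ M.1 ≠ ⊥ := by
    intro h; rw [h, finrank_bot] at h1; omega
  obtain ⟨v, hv, hv0⟩ := Submodule.exists_mem_ne_zero_of_ne_bot h3
  exact ⟨mkPt v hv0, (incid_mk _ _ _).2 hv.1, (incid_mk _ _ _).2 hv.2⟩

theorem aff_card [Fintype F] (l m : Ln F) (h : m ≠ l) : (AffPts l m).ncard = Fintype.card F := by
  obtain ⟨U, hUm, hUl⟩ := meet_ex m l
  obtain ⟨u, hu, rfl⟩ := exists_mk U
  have hnle : ¬ m.1 ≤ l.1 := fun hle =>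
    h (Subtype.ext (Submodule.eq_of_le_of_finrank_eq hle (by rw [m.2, l.2])))
  obtain ⟨v, hvm, hvl⟩ := SetLike.not_le_iff_exists.1 hnle
  rw [incid_mk] at hUm hUl
  have hv0 : v ≠ 0 := by rintro rfl; exact hvl l.1.zero_mem
  have hl : ∀ t : F, v + t • u ∉ l.1 := fun t ht => hvl (by
    have := l.1.sub_mem ht (l.1.smul_mem t hUl); simpa using this)
  have hne : ∀ t : F, v + t • u ≠ 0 := fun t ht => hl t (by rw [ht]; exact l.1.zero_mem)
  have huv : mkPt u hu ≠ mkPt v hv0 := by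
    intro e
    apply hvl
    rw [← incid_mk v hv0, ← e, incid_mk]; exact hUl
  have hr : AffPts l m = (fun t => mkPt (v + t • u) (hne t)) '' Set.univ := by
    ext P
    obtain ⟨w, hw, rfl⟩ := exists_mk P
    simp only [AffPts, Set.mem_ofPred_eq, incid_mk, Set.image_univ, Set.mem_range]
    constructor
    · rintro ⟨hwm, hwl⟩
      have e1 : (mkPt u hu).1 ⊔ (mkPt v hv0).1 = m.1 :=
        Submodule.eq_of_le_of_finrank_eq
          (sup_le ((incid_mk u hu m).2 hUm) ((incid_mk v hv0 m).2 hvm))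
          (by rw [sup_fin _ _ huv, m.2])
      rw [← e1] at hwm
      obtain ⟨x, hx, y, hy, rfl⟩ := Submodule.mem_sup.1 hwm
      obtain ⟨s, rfl⟩ := Submodule.mem_span_singleton.1 hx
      obtain ⟨r, rfl⟩ := Submodule.mem_span_singleton.1 hy
      have hr0 : r ≠ 0 := by
        rintro rfl
        apply hwl; simpa using l.1.smul_mem s hUl
      refine ⟨s / r, ?_⟩
      apply Subtype.ext
      simp only [mkPt]
      have e : s • u + r • v = r • (v + (s / r) • u) := by
        rw [smul_add, smul_smul, mul_div_cancel₀ _ hr0, add_comm]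
      rw [e]
      exact (Submodule.span_singleton_smul_eq (IsUnit.mk0 r hr0) _).symm
    · rintro ⟨t, ht⟩
      rw [← incid_mk w hw, ← incid_mk w hw l, ← ht, incid_mk, incid_mk]
      exact ⟨m.1.add_mem hvm (m.1.smul_mem t hUm), hl t⟩
  rw [hr, Set.ncard_image_of_injective, Set.ncard_univ, Nat.card_eq_fintype_card]
  intro s t hst
  by_contra hne'
  have h1 : v + s • u ∈ (mkPt (v + t • u) (hne t)).1 := by
    have : mkPt (v + s • u) (hne s) = mkPt (v + t • u) (hne t) := hst
    rw [← this]; exact Submodule.mem_span_singleton_self _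
  obtain ⟨r, hr⟩ := Submodule.mem_span_singleton.1 h1
  have h2 : (1 - r) • v = (r * t - s) • u := by
    have : (1 - r) • v = v + s • u - r • (v + t • u) + (r * t - s) • u := by
      module
    rw [this, hr]; simp
  have h3 : r = 1 := by
    by_contra h4
    apply hvl
    have h5 : (1 - r) ≠ 0 := sub_ne_zero.2 (Ne.symm h4)
    rw [← Submodule.smul_mem_iff _ h5, h2]
    exact l.1.smul_mem _ hUl
  subst h3
  simp only [sub_self, zero_smul, one_mul] at h2
  rcases smul_eq_zero.1 h2.symm with h4 | h4
  · exact hne' (sub_eq_zero.1 h4).symm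
  · exact hu h4

theorem aff_third [Fintype F] (hq : 3 ≤ Fintype.card F) (l m : Ln F) (h : m ≠ l) (X Y : Pt F) :
    ∃ Z, Incid Z m ∧ ¬ Incid Z l ∧ Z ≠ X ∧ Z ≠ Y := by
  have hc := aff_card l m h
  have h2 : ({X, Y} : Set (Pt F)).ncard < (AffPts l m).ncard := by
    have := Set.ncard_insert_le X {Y}
    rw [Set.ncard_singleton] at this
    omega
  obtain ⟨Z, hZ, hn⟩ := Set.exists_mem_notMem_of_ncard_lt_ncard h2
  simp only [Set.mem_insert_iff, Set.mem_singleton_iff, not_or] at hn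
  exact ⟨Z, hZ.1, hZ.2, hn.1, hn.2⟩

/-- Two parallel affine lines `a, b` and a third affine line `c` not parallel to them,
minus the two intersection points `A = b ∩ c`, `B = a ∩ c`, form a minimal affine
blocking set of size `3q-4` with the Π-strong property with respect to the direction
`Π_c`; moreover every line of `Π_c` other than `c` is a secant to it. -/
theorem parallel_lines_minimalAffBlocking
    (F : Type) [Field F] [Fintype F] (hq : 3 ≤ Fintype.card F)
    (l a b c : Ln F) (hal : a ≠ l) (hbl : b ≠ l) (hcl : c ≠ l) (hab : a ≠ b)
    (hpar : ∀ Q : Pt F, Incid Q a → Incid Q b → Incid Q l)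
    (A B : Pt F)
    (hA : Incid A b ∧ Incid A c ∧ ¬ Incid A l)
    (hB : Incid B a ∧ Incid B c ∧ ¬ Incid B l)
    (Pinf : Pt F) (hPinf : Incid Pinf c ∧ Incid Pinf l)
    (Bl : Set (Pt F))
    (hBl : Bl = (AffPts l a ∪ AffPts l b ∪ AffPts l c) \ {A, B}) :
    IsMinimalAffBlocking l Bl ∧ Bl.ncard = 3 * Fintype.card F - 4 ∧
    PiStrong l Pinf Bl ∧
    ∀ m : Ln F, m ≠ l → m ≠ c → Incid Pinf m → IsSecant Bl m := by

  have U := @join_uniq F _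
  have hca : c ≠ a := by rintro rfl; exact hA.2.2 (hpar A hA.2.1 hA.1)
  have hcb : c ≠ b := by rintro rfl; exact hB.2.2 (hpar B hB.1 hB.2.1)
  obtain ⟨hAb, hAc, hAl⟩ := hA
  obtain ⟨hBa, hBc, hBl'⟩ := hB
  obtain ⟨hPc, hPl⟩ := hPinf
  have hAa : ¬ Incid A a := fun h => hAl (hpar A h hAb)
  have hBb : ¬ Incid B b := fun h => hBl' (hpar B hBa h)
  have hAB : A ≠ B := by rintro rfl; exact hAa hBa
  have mem : ∀ P, P ∈ Bl ↔ ((Incid P a ∨ Incid P b ∨ Incid P c) ∧ ¬ Incid P l ∧ P ≠ A ∧ P ≠ B) := by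
    intro P; rw [hBl]
    simp only [AffPts, Set.mem_sdiff, Set.mem_union, Set.mem_ofPred_eq, Set.mem_insert_iff,
      Set.mem_singleton_iff]
    clear * -
    tauto
  -- the common point of a, b, l
  obtain ⟨D, hDa, hDb⟩ := meet_ex a b
  have hDl := hpar D hDa hDb
  have hDc : ¬ Incid D c := by
    intro h
    have : D ≠ B := by rintro rfl; exact hBl' hDl
    exact hca (U D B c a this h hBc hDa hBa)
  have hPa : ¬ Incid Pinf a := by
    intro h
    exact hca (U Pinf B c a (by rintro rfl; exact hBl' hPl) hPc hBc h hBa)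
  have hPb : ¬ Incid Pinf b := by
    intro h
    exact hcb (U Pinf A c b (by rintro rfl; exact hAl hPl) hPc hAc h hAb)
  have third := aff_third hq l
  -- points on two lines
  have ca : ∀ X, Incid X c → Incid X a → X = B := fun X h1 h2 => by
    by_contra h; exact hca (U X B c a h h1 hBc h2 hBa)
  have cb : ∀ X, Incid X c → Incid X b → X = A := fun X h1 h2 => by
    by_contra h; exact hcb (U X A c b h h1 hAc h2 hAb)
  -- m not through D, m ≠ l meets a and b in affine points
  have al : ∀ X, Incid X a → Incid X l → X = D := fun X h1 h2 => by
    by_contra h; exact hal (U X D a l h h1 hDa h2 hDl)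
  have bl : ∀ X, Incid X b → Incid X l → X = D := fun X h1 h2 => by
    by_contra h; exact hbl (U X D b l h h1 hDb h2 hDl)
  have cl : ∀ X, Incid X c → Incid X l → X = Pinf := fun X h1 h2 => by
    by_contra h; exact hcl (U X Pinf c l h h1 hPc h2 hPl)
  have meets : ∀ m, ¬ Incid D m → ∃ X Y, Incid X a ∧ Incid Y b ∧ Incid X m ∧ Incid Y m ∧
      ¬ Incid X l ∧ ¬ Incid Y l ∧ X ≠ Y := by
    intro m hD
    obtain ⟨X, hX, hXm⟩ := meet_ex a m
    obtain ⟨Y, hY, hYm⟩ := meet_ex b m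
    have h1 : ¬ Incid X l := fun h => hD (al X hX h ▸ hXm)
    refine ⟨X, Y, hX, hY, hXm, hYm, h1, fun h => hD (bl Y hY h ▸ hYm), ?_⟩
    rintro rfl
    exact h1 (hpar _ hX hY)
  have sec : ∀ m : Ln F, m ≠ l → m ≠ c → Incid Pinf m → IsSecant Bl m := by
    intro m hml hmc hPm
    have hDm : ¬ Incid D m := fun h => hml
      (U D Pinf m l (by rintro rfl; exact hDc hPc) h hPm hDl hPl)
    obtain ⟨X, Y, hXa, hYb, hXm, hYm, hXl, hYl, hXY⟩ := meets m hDm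
    have nc : ∀ Z, Incid Z m → ¬ Incid Z l → ¬ Incid Z c := fun Z h1 h2 h3 => hmc
      (U Z Pinf m c (by rintro rfl; exact h2 hPl) h1 hPm h3 hPc)
    refine ⟨X, Y, hXY, (mem X).2 ⟨Or.inl hXa, hXl, ?_, ?_⟩,
      (mem Y).2 ⟨Or.inr (Or.inl hYb), hYl, ?_, ?_⟩, hXm, hYm⟩
    · rintro rfl; exact nc _ hXm hXl hAc
    · rintro rfl; exact nc _ hXm hXl hBc
    · rintro rfl; exact nc _ hYm hYl hAc
    · rintro rfl; exact nc _ hYm hYl hBc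
  have block : IsAffBlocking l Bl := by
    refine ⟨fun P hP => ((mem P).1 hP).2.1, ?_⟩
    intro m hml
    by_cases hmc : m = c
    · subst hmc
      obtain ⟨Z, h1, h2, h3, h4⟩ := third m hml A B
      exact ⟨Z, (mem Z).2 ⟨Or.inr (Or.inr h1), h2, h3, h4⟩, h1⟩
    by_cases hma : m = a
    · subst hma
      obtain ⟨Z, h1, h2, h3, h4⟩ := third m hml A B
      exact ⟨Z, (mem Z).2 ⟨Or.inl h1, h2, h3, h4⟩, h1⟩
    by_cases hmb : m = b
    · subst hmb
      obtain ⟨Z, h1, h2, h3, h4⟩ := third m hml A B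
      exact ⟨Z, (mem Z).2 ⟨Or.inr (Or.inl h1), h2, h3, h4⟩, h1⟩
    by_cases hD : Incid D m
    · obtain ⟨Z, hZm, hZc⟩ := meet_ex m c
      have hZD : Z ≠ D := by rintro rfl; exact hDc hZc
      refine ⟨Z, (mem Z).2 ⟨Or.inr (Or.inr hZc), ?_, ?_, ?_⟩, hZm⟩
      · exact fun h => hml (U Z D m l hZD hZm hD h hDl)
      · rintro rfl; exact hmb (U _ D m b hZD hZm hD hAb hDb)
      · rintro rfl; exact hma (U _ D m a hZD hZm hD hBa hDa)
    · obtain ⟨X, Y, hXa, hYb, hXm, hYm, hXl, hYl, hXY⟩ := meets m hD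
      by_cases hXB : X = B
      · refine ⟨Y, (mem Y).2 ⟨Or.inr (Or.inl hYb), hYl, ?_, ?_⟩, hYm⟩
        · rintro rfl; subst hXB; exact hmc (U _ _ m c hXY hXm hYm hBc hAc)
        · rintro rfl; exact hBb hYb
      · exact ⟨X, (mem X).2 ⟨Or.inl hXa, hXl, by rintro rfl; exact hAa hXa, hXB⟩, hXm⟩
  -- tangents
  have tan1 : ∀ (a b : Ln F) (A B : Pt F), 
      (∀ P, P ∈ Bl ↔ ((Incid P a ∨ Incid P b ∨ Incid P c) ∧ ¬ Incid P l ∧ P ≠ A ∧ P ≠ B)) →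
      Incid A b → Incid A c → ¬ Incid A l → ¬ Incid A a → ¬ Incid B b → 
      a ≠ l → (∀ Q, Incid Q a → Incid Q b → Incid Q l) → 
      (∀ X, Incid X c → Incid X a → X = B) → 
      ∀ Q ∈ Bl, Incid Q a → 
      ∃! m : Ln F, m ≠ l ∧ ¬ Incid Pinf m ∧ Incid Q m ∧ IsTangent Bl m := by
    intro a b A B mem hAb hAc hAl hAa hBb hal hpar ca Q hQ hQa
    obtain ⟨-, hQl, hQA, hQB⟩ := (mem Q).1 hQ
    have hQc : ¬ Incid Q c := fun h => hQB (ca Q h hQa)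
    obtain ⟨m, hQm, hAm⟩ := join_ex Q A hQA
    have hma : m ≠ a := by rintro rfl; exact hAa hAm
    have hmb : m ≠ b := by rintro rfl; exact hQl (hpar _ hQa hQm)
    have hmc : m ≠ c := by rintro rfl; exact hQc hQm
    refine ⟨m, ⟨?_, ?_, hQm, Q, ⟨hQ, hQm⟩, ?_⟩, ?_⟩
    · rintro rfl; exact hAl hAm
    · intro h; exact hmc (U Pinf A m c (by rintro rfl; exact hAl hPl) h hAm hPc hAc)
    · rintro X ⟨hX, hXm⟩
      obtain ⟨h1, hXl, hXA, hXB⟩ := (mem X).1 hX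
      by_contra hXQ
      rcases h1 with h1 | h1 | h1
      · exact hma (U X Q m a hXQ hXm hQm h1 hQa)
      · exact hmb (U X A m b hXA hXm hAm h1 hAb)
      · exact hmc (U X A m c hXA hXm hAm h1 hAc)
    · rintro n ⟨hnl, hnP, hQn, T, -, hT⟩
      have hT' : ∀ X, X ∈ Bl → Incid X n → X = Q := fun X h1 h2 =>
        (hT X ⟨h1, h2⟩).trans (hT Q ⟨hQ, hQn⟩).symm
      by_cases hna : n = a
      · subst hna
        obtain ⟨Z, h1, h2, h3, h4⟩ := third n hnl Q B
        exact absurd (hT' Z ((mem Z).2 ⟨Or.inl h1, h2, by rintro rfl; exact hAa h1, h4⟩) h1) h3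
      obtain ⟨Y, hYb, hYn⟩ := meet_ex b n
      by_cases hYA : Y = A
      · subst hYA
        exact U Q Y n m hQA hQn hYn hQm hAm
      exfalso
      by_cases hYl : Incid Y l
      · -- n meets c in a point of Bl
        obtain ⟨Z, hZc, hZn⟩ := meet_ex c n
        have hYQ : Y ≠ Q := by rintro rfl; exact hQl hYl
        have hZQ : Z ≠ Q := by rintro rfl; exact hQc hZc
        have hZl : ¬ Incid Z l := fun h => by
          rw [cl Z hZc h] at hZn; exact hnP hZn
        have hZA : Z ≠ A := by
          rintro rfl
          have hbn : b = n := U Y Z b n hYA hYb hAb hYn hZn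
          subst hbn
          exact hQl (hpar Q hQa hQn)
        have hZB : Z ≠ B := by
          rintro rfl
          have hBc := hZc
          exact hna (U Z Q n a hZQ hZn hQn (by
            obtain ⟨W, hWc, hWa⟩ := meet_ex c a
            exact ca W hWc hWa ▸ hWa) hQa)
        exact hZQ (hT' Z ((mem Z).2 ⟨Or.inr (Or.inr hZc), hZl, hZA, hZB⟩) hZn)
      · have : Y = Q := hT' Y ((mem Y).2 ⟨Or.inr (Or.inl hYb), hYl, hYA, by
          rintro rfl; exact hBb hYb⟩) hYn
        subst this
        exact hYl (hpar _ hQa hYb)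
  have tan2 : ∀ Q ∈ Bl, Incid Q c → 
      ∃! m : Ln F, m ≠ l ∧ ¬ Incid Pinf m ∧ Incid Q m ∧ IsTangent Bl m := by
    intro Q hQ hQc
    obtain ⟨-, hQl, hQA, hQB⟩ := (mem Q).1 hQ
    have hQa : ¬ Incid Q a := fun h => hQB (ca Q hQc h)
    have hQb : ¬ Incid Q b := fun h => hQA (cb Q hQc h)
    have hQD : Q ≠ D := by rintro rfl; exact hQl hDl
    obtain ⟨m, hQm, hDm⟩ := join_ex Q D hQD
    have hma : m ≠ a := by rintro rfl; exact hQa hQm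
    have hmb : m ≠ b := by rintro rfl; exact hQb hQm
    have hmc : m ≠ c := by rintro rfl; exact hDc hDm
    have hml : m ≠ l := by rintro rfl; exact hQl hQm
    refine ⟨m, ⟨hml, ?_, hQm, Q, ⟨hQ, hQm⟩, ?_⟩, ?_⟩
    · intro h; exact hmc (U Pinf Q m c (by rintro rfl; exact hQl hPl) h hQm hPc hQc)
    · rintro X ⟨hX, hXm⟩
      obtain ⟨h1, hXl, hXA, hXB⟩ := (mem X).1 hX
      have hXD : X ≠ D := by rintro rfl; exact hXl hDl
      by_contra hXQ
      rcases h1 with h1 | h1 | h1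
      · exact hma (U X D m a hXD hXm hDm h1 hDa)
      · exact hmb (U X D m b hXD hXm hDm h1 hDb)
      · exact hmc (U X Q m c hXQ hXm hQm h1 hQc)
    · rintro n ⟨hnl, hnP, hQn, T, -, hT⟩
      have hT' : ∀ X, X ∈ Bl → Incid X n → X = Q := fun X h1 h2 =>
        (hT X ⟨h1, h2⟩).trans (hT Q ⟨hQ, hQn⟩).symm
      by_cases hD : Incid D n
      · exact U Q D n m hQD hQn hD hQm hDm
      exfalso
      obtain ⟨X, Y, hXa, hYb, hXn, hYn, hXl, hYl, hXY⟩ := meets n hD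
      have hXQ : X ≠ Q := by rintro rfl; exact hQa hXa
      have hnc : n ≠ c := by rintro rfl; exact hnP hPc
      refine hXQ (hT' X ((mem X).2 ⟨Or.inl hXa, hXl, by rintro rfl; exact hAa hXa, ?_⟩) hXn)
      rintro rfl
      exact hnc (U X Q n c hXQ hXn hQn hBc hQc)
  have mem' : ∀ P, P ∈ Bl ↔
      ((Incid P b ∨ Incid P a ∨ Incid P c) ∧ ¬ Incid P l ∧ P ≠ B ∧ P ≠ A) := by
    intro P; rw [mem]; clear * -; tauto
  have strong : PiStrong l Pinf Bl := by
    constructor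
    · intro Q hQ
      rcases ((mem Q).1 hQ).1 with h | h | h
      · exact tan1 a b A B mem hAb hAc hAl hAa hBb hal hpar ca Q hQ h
      · exact tan1 b a B A mem' hBa hBc hBl' hBb hAa hbl (fun Q h1 h2 => hpar Q h2 h1) cb Q hQ h
      · exact tan2 Q hQ h
    · intro m hml hPm hsub
      by_cases hmc : m = c
      · subst hmc
        exact ((mem A).1 (hsub ⟨hAc, hAl⟩)).2.2.1 rfl
      obtain ⟨X, hXa, hXm⟩ := meet_ex a m
      obtain ⟨Y, hYb, hYm⟩ := meet_ex b m
      obtain ⟨Z, h1, h2, h3, h4⟩ := third m hml X Y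
      rcases ((mem Z).1 (hsub ⟨h1, h2⟩)).1 with h | h | h
      · have := U Z X m a h3 h1 hXm h hXa
        subst this; exact hPa hPm
      · have := U Z Y m b h4 h1 hYm h hYb
        subst this; exact hPb hPm
      · exact hmc (U Z Pinf m c (by rintro rfl; exact h2 hPl) h1 hPm h hPc)
  refine ⟨⟨block, ?_⟩, ?_, strong, sec⟩
  · intro B' hB' hblk
    obtain ⟨Q, hQ, hQ'⟩ := Set.exists_of_ssubset hB'
    obtain ⟨m, ⟨hml, -, hQm, T, -, hT⟩, -⟩ := strong.1 Q hQ
    obtain ⟨P, hP, hPm⟩ := hblk.2 m hml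
    have : P = Q := (hT P ⟨hB'.1 hP, hPm⟩).trans (hT Q ⟨hQ, hQm⟩).symm
    exact hQ' (this ▸ hP)
  · have fin : ∀ m : Ln F, m ≠ l → (AffPts l m).Finite := fun m hm =>
      Set.finite_of_ncard_pos (by rw [aff_card l m hm]; omega)
    have e : Bl = (AffPts l a \ {B}) ∪ ((AffPts l b \ {A}) ∪ (AffPts l c \ {A, B})) := by
      ext P
      rw [mem]
      simp only [AffPts, Set.mem_sdiff, Set.mem_union, Set.mem_ofPred_eq, Set.mem_insert_iff,
        Set.mem_singleton_iff]
      have h1 : Incid P a → P ≠ A := by rintro h rfl; exact hAa h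
      have h2 : Incid P b → P ≠ B := by rintro h rfl; exact hBb h
      clear * - h1 h2
      tauto
    have c1 : (AffPts l a \ {B}).ncard = Fintype.card F - 1 := by
      rw [Set.ncard_sdiff_singleton_of_mem (show B ∈ AffPts l a from ⟨hBa, hBl'⟩), aff_card l a hal]
    have c2 : (AffPts l b \ {A}).ncard = Fintype.card F - 1 := by
      rw [Set.ncard_sdiff_singleton_of_mem (show A ∈ AffPts l b from ⟨hAb, hAl⟩), aff_card l b hbl]
    have c3 : (AffPts l c \ {A, B}).ncard = Fintype.card F - 2 := by
      rw [Set.ncard_sdiff, aff_card l c hcl, Set.ncard_pair hAB]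
      rintro X (rfl | rfl)
      · exact ⟨hAc, hAl⟩
      · exact ⟨hBc, hBl'⟩
    rw [e, Set.ncard_union_eq _ ((fin a hal).sdiff) (((fin b hbl).sdiff).union ((fin c hcl).sdiff)),
      Set.ncard_union_eq _ ((fin b hbl).sdiff) ((fin c hcl).sdiff), c1, c2, c3]
    · omega
    · rw [Set.disjoint_left]
      rintro X ⟨⟨h1, h2⟩, h3⟩ ⟨⟨h4, h5⟩, h6⟩
      exact h3 (cb X h4 h1)
    · rw [Set.disjoint_left]
      rintro X ⟨⟨h1, h2⟩, h3⟩ (⟨⟨h4, h5⟩, h6⟩ | ⟨⟨h4, h5⟩, h6⟩)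
      · exact h2 (hpar X h1 h4)
      · exact h3 (ca X h4 h1)
end

section
/- In the projective plane PG(2,4) there exists a minimal blocking set of size 8 = 3·4−4 which has the r∞-property with respect to some point of it. -/
variable {F : Type} [Field F]

namespace PG24

def ad : Fin 4 → Fin 4 → Fin 4 :=
  ![![0,1,2,3],![1,0,3,2],![2,3,0,1],![3,2,1,0]]

def ml : Fin 4 → Fin 4 → Fin 4 :=
  ![![0,0,0,0],![0,1,2,3],![0,2,3,1],![0,3,1,2]]

abbrev V := Fin 4 × Fin 4 × Fin 4

def dt (u v : V) : Fin 4 :=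
  ad (ad (ml u.1 v.1) (ml u.2.1 v.2.1)) (ml u.2.2 v.2.2)

def sm (c : Fin 4) (v : V) : V := (ml c v.1, ml c v.2.1, ml c v.2.2)

def bb : Fin 8 → V :=
  ![(1,0,0),(0,0,1),(0,1,0),(0,1,1),(0,1,2),(1,0,1),(1,0,2),(1,1,0)]

def tt : Fin 8 → V :=
  ![(0,1,2),(1,2,0),(1,0,2),(1,2,2),(1,3,2),(1,3,1),(1,2,3),(1,1,2)]

set_option maxRecDepth 100000
set_option maxHeartbeats 4000000

lemma c_nz : ∀ i, bb i ≠ (0,0,0) := by decide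
lemma t_nz : ∀ i, tt i ≠ (0,0,0) := by decide
lemma c1 : ∀ a b c : Fin 4, ∃ i, dt (a,b,c) (bb i) = 0 := by decide
def wit : List V := [(1,1,1),(1,2,0),(1,3,0),(1,2,1),(1,1,2),(0,1,3),(1,0,3),(1,2,2),(1,3,3),
  (1,1,3),(1,2,3),(1,3,1),(1,3,2)]
lemma c2 : ∀ a b c : Fin 4, ∃ v ∈ wit, dt (a,b,c) v = 0 := by decide
lemma c2' : ∀ v ∈ wit, v ≠ (0,0,0) ∧ ∀ i c, sm c (bb i) ≠ v := by decide
lemma c3 : ∀ i j, dt (tt i) (bb j) = 0 ↔ i = j := by decide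
lemma c5 : ∀ a b c : Fin 4, (a,b,c) ≠ ((0,0,0) : V) → dt (a,b,c) (bb 0) = 0 →
    (∃ j, j ≠ 0 ∧ dt (a,b,c) (bb j) = 0) ∨ ∃ k, k ≠ 0 ∧ (a,b,c) = sm k (tt 0) := by decide

section

def ph (w : F) : Fin 4 → F := ![0,1,w,w+1]

def vc (w : F) (v : V) : Fin 3 → F := ![ph w v.1, ph w v.2.1, ph w v.2.2]

lemma exists_w [Fintype F] (hq : Fintype.card F = 4) :
    ∃ w : F, w*w = w+1 ∧ (1:F)+1 = 0 ∧ w ≠ 0 ∧ w ≠ 1 := by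
  classical
  have h4 : ((4:ℕ) : F) = 0 := by rw [← hq]; exact Nat.cast_card_eq_zero F
  have h2 : (1:F)+1 = 0 := by
    have : ((1:F)+1)*(1+1) = 0 := by rw [← h4]; push_cast; ring
    exact mul_self_eq_zero.mp this
  obtain ⟨w, hw⟩ : ∃ w : F, w ∉ ({0,1} : Finset F) := by
    by_contra! h
    have h5 : (Finset.univ : Finset F) ⊆ {0,1} := fun x _ => h x
    have h6 := Finset.card_le_card h5
    have h7 := Finset.card_le_two (a := (0:F)) (b := 1)
    rw [Finset.card_univ, hq] at h6
    omega
  simp only [Finset.mem_insert, Finset.mem_singleton, not_or] at hw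
  refine ⟨w, ?_, h2, hw.1, hw.2⟩
  have hp := FiniteField.pow_card w
  rw [hq] at hp
  have h8 : w * ((w-1) * (w*w+w+1)) = 0 := by linear_combination hp
  have h9 := (mul_eq_zero.mp ((mul_eq_zero.mp h8).resolve_left hw.1)).resolve_left
    (sub_ne_zero.mpr hw.2)
  linear_combination h9 - (w+1)*h2

section
variable {w : F} (h1 : w*w = w+1) (h2 : (1:F)+1 = 0) (h0 : w ≠ 0) (h3 : w ≠ 1)
include h1 h2

lemma ph_add (a b : Fin 4) : ph w (ad a b) = ph w a + ph w b := by
  have h2' : w + w = 0 := by linear_combination w*h2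
  fin_cases a <;> fin_cases b <;> simp [ph, ad] <;> grind

lemma ph_mul (a b : Fin 4) : ph w (ml a b) = ph w a * ph w b := by
  fin_cases a <;> fin_cases b <;> simp [ph, ml] <;> grind

include h0 h3
lemma ph_inj : Function.Injective (ph w) := by
  intro a b
  fin_cases a <;> fin_cases b <;> simp [ph] <;> grind

lemma ph_zero (a : Fin 4) : ph w a = 0 ↔ a = 0 := by
  rw [← (ph_inj h1 h2 h0 h3).eq_iff (a := a)]; simp [ph]

lemma vc_zero (v : V) : vc w v = 0 ↔ v = (0,0,0) := by
  obtain ⟨a,b,c⟩ := v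
  simp [vc, ph_zero h1 h2 h0 h3]

lemma vc_inj : Function.Injective (vc w) := by
  rintro ⟨a,b,c⟩ ⟨d,e,f⟩ h
  have i := ph_inj h1 h2 h0 h3
  have e0 := i (congrFun h 0)
  have e1 := i (congrFun h 1)
  have e2 := i (congrFun h 2)
  change a = d at e0
  change b = e at e1
  change c = f at e2
  rw [e0, e1, e2]

lemma ph_surj [Fintype F] (hq : Fintype.card F = 4) : Function.Surjective (ph w) :=
  ((Fintype.bijective_iff_injective_and_card _).mpr ⟨ph_inj h1 h2 h0 h3, by simp [hq]⟩).2

lemma vc_surj [Fintype F] (hq : Fintype.card F = 4) : Function.Surjective (vc w) := by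
  intro x
  have s := ph_surj h1 h2 h0 h3 hq
  obtain ⟨a, ha⟩ := s (x 0)
  obtain ⟨b, hb⟩ := s (x 1)
  obtain ⟨c, hc⟩ := s (x 2)
  refine ⟨(a,b,c), ?_⟩
  ext i
  fin_cases i <;> simp [vc, ha, hb, hc]

lemma dot_iff (u v : V) : vc w u ⬝ᵥ vc w v = 0 ↔ dt u v = 0 := by
  rw [← ph_zero h1 h2 h0 h3, dt, ph_add h1 h2, ph_add h1 h2, ph_mul h1 h2, ph_mul h1 h2,
    ph_mul h1 h2]
  simp [vc, dotProduct, Fin.sum_univ_three]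

lemma vc_sm (c : Fin 4) (v : V) : vc w (sm c v) = ph w c • vc w v := by
  ext i
  fin_cases i <;> simp [vc, sm, ph_mul h1 h2]

end

def Rep (L : Ln F) (u : Fin 3 → F) : Prop := ∀ x, x ∈ L.1 ↔ u ⬝ᵥ x = 0

lemma finrank_ker (f : (Fin 3 → F) →ₗ[F] F) (hf : f ≠ 0) :
    Module.finrank F (LinearMap.ker f) = 2 := by
  have h := LinearMap.finrank_range_add_finrank_ker f
  rw [LinearMap.range_eq_top.mpr (LinearMap.surjective hf)] at h
  simp at h
  omega

lemma exists_rep (L : Ln F) : ∃ u, u ≠ 0 ∧ Rep L u := by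
  have hlt : L.1 < ⊤ := by
    rw [lt_top_iff_ne_top]
    intro h
    have := L.2
    rw [h] at this
    simp at this
  obtain ⟨f, hf, hL⟩ := Submodule.exists_le_ker_of_lt_top L.1 hlt
  have he : L.1 = LinearMap.ker f :=
    Submodule.eq_of_le_of_finrank_eq hL (by rw [finrank_ker f hf, L.2])
  have hx : ∀ x, f x = (fun i => f (Pi.single i 1)) ⬝ᵥ x := by
    intro x
    rw [LinearMap.pi_apply_eq_sum_univ f x]
    simp only [dotProduct, smul_eq_mul]
    refine Finset.sum_congr rfl fun i _ => ?_
    rw [mul_comm]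
    congr 2
    ext j
    simp [Pi.single_apply, eq_comm]
  refine ⟨fun i => f (Pi.single i 1), ?_, ?_⟩
  · intro h
    apply hf
    ext1 x
    ext
    simpa using congrFun h x
  · intro x
    rw [he, LinearMap.mem_ker, hx]

lemma rep_exists (u : Fin 3 → F) (hu : u ≠ 0) : ∃ L : Ln F, Rep L u := by
  refine ⟨⟨LinearMap.ker (dotProductBilin F F u), finrank_ker _ ?_⟩, fun x => ?_⟩
  · intro h
    apply hu
    ext i
    simpa using LinearMap.congr_fun h (Pi.single i 1)
  · simp

lemma rep_eq {L M : Ln F} {u v : Fin 3 → F} (hL : Rep L u) (hM : Rep M v) (k : F) (hk : k ≠ 0)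
    (h : u = k • v) : L = M := by
  apply Subtype.ext
  ext x
  rw [hL x, hM x, h]
  simp [hk]

def mk (v : Fin 3 → F) (hv : v ≠ 0) : Pt F :=
  ⟨Submodule.span F {v}, finrank_span_singleton hv⟩

lemma incid_mk {L : Ln F} {u : Fin 3 → F} (hL : Rep L u) (v : Fin 3 → F) (hv : v ≠ 0) :
    Incid (mk v hv) L ↔ u ⬝ᵥ v = 0 := by
  rw [← hL, Incid, mk, Submodule.span_singleton_le_iff_mem]

end
end PG24

open PG24 in
/-- In PG(2,4) there is a minimal blocking set of size `8 = 3·4-4` with the r∞-property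
with respect to some of its points. -/
theorem exists_minimalBlocking_PG24_size_eight
    (F : Type) [Field F] [Fintype F] (hq : Fintype.card F = 4) :
    ∃ B : Set (Pt F), IsMinimalBlocking B ∧ B.ncard = 8 ∧
      ∃ P ∈ B, HasRInftyAt B P := by
  obtain ⟨w, h1, h2, h0, h3⟩ := exists_w hq
  have nz := vc_zero h1 h2 h0 h3
  have D := dot_iff h1 h2 h0 h3
  have S := vc_surj h1 h2 h0 h3 hq
  have bnz : ∀ i, vc w (bb i) ≠ 0 := fun i h => c_nz i ((nz _).mp h)
  let p : Fin 8 → Pt F := fun i => mk (vc w (bb i)) (bnz i)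
  have inc : ∀ {L : Ln F} {u : V}, Rep L (vc w u) → ∀ i, Incid (p i) L ↔ dt u (bb i) = 0 :=
    fun hL i => (incid_mk hL _ _).trans (D _ _)
  have rep : ∀ L : Ln F, ∃ u : V, u ≠ (0,0,0) ∧ Rep L (vc w u) := by
    intro L
    obtain ⟨x, hx, hr⟩ := exists_rep L
    obtain ⟨u, rfl⟩ := S x
    exact ⟨u, fun h => hx ((nz u).mpr h), hr⟩
  have tl : ∀ i, ∃ L : Ln F, Rep L (vc w (tt i)) := fun i =>
    rep_exists _ (fun h => t_nz i ((nz _).mp h))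
  choose T hT using tl
  have incT : ∀ i j, Incid (p j) (T i) ↔ i = j := fun i j => (inc (hT i) j).trans (c3 i j)
  have pinj : Function.Injective p := by
    intro i j h
    have := (incT i i).mpr rfl
    rw [h] at this
    exact (incT i j).mp this
  refine ⟨Set.range p, ⟨⟨?_, ?_⟩, ?_⟩, ?_, p 0, ⟨0, rfl⟩, T 0, (incT 0 0).mpr rfl, ?_, ?_⟩
  · intro L
    obtain ⟨⟨a,b,c⟩, -, hu⟩ := rep L
    obtain ⟨i, hi⟩ := c1 a b c
    exact ⟨p i, ⟨i, rfl⟩, (inc hu i).mpr hi⟩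
  · intro L
    obtain ⟨⟨a,b,c⟩, -, hu⟩ := rep L
    obtain ⟨v, hv, hd⟩ := c2 a b c
    obtain ⟨hv0, hv⟩ := c2' v hv
    have hvz : vc w v ≠ 0 := fun h => hv0 ((nz v).mp h)
    refine ⟨mk (vc w v) hvz, (incid_mk hu _ _).mpr ((D _ _).mpr hd), ?_⟩
    rintro ⟨i, hi⟩
    have hm : vc w v ∈ (p i).1 := by
      rw [hi]
      exact Submodule.mem_span_singleton_self _
    obtain ⟨k, hk⟩ := Submodule.mem_span_singleton.mp hm
    obtain ⟨k, rfl⟩ := ph_surj h1 h2 h0 h3 hq k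
    rw [← vc_sm h1 h2 h0 h3] at hk
    exact hv i k (vc_inj h1 h2 h0 h3 hk)
  · rintro B' hB ⟨hb, -⟩
    obtain ⟨hs, x, ⟨i, rfl⟩, hx⟩ := Set.ssubset_iff_exists.mp hB
    obtain ⟨Q, hQ, hQi⟩ := hb (T i)
    obtain ⟨j, rfl⟩ := hs hQ
    rw [(incT i j).mp hQi] at hx
    exact hx hQ
  · rw [← Set.image_univ, Set.ncard_image_of_injective _ pinj]
    simp [Set.ncard_univ]
  · refine ⟨p 0, ⟨⟨0, rfl⟩, (incT 0 0).mpr rfl⟩, ?_⟩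
    rintro Q ⟨⟨j, rfl⟩, hj⟩
    rw [(incT 0 j).mp hj]
  · intro L hL hne
    obtain ⟨⟨a,b,c⟩, hu0, hu⟩ := rep L
    rcases c5 a b c hu0 ((inc hu 0).mp hL) with ⟨j, hj, hd⟩ | ⟨k, hk, he⟩
    · exact ⟨p 0, p j, fun h => hj (pinj h).symm, ⟨0, rfl⟩, ⟨j, rfl⟩, hL, (inc hu j).mpr hd⟩
    · refine absurd (rep_eq hu (hT 0) (ph w k) ?_ ?_) hne
      · exact fun h => hk ((ph_zero h1 h2 h0 h3 k).mp h)
      · rw [he, vc_sm h1 h2 h0 h3]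
end

section
/- (Jamison; Brouwer–Schrijver) For every prime power q, every affine blocking set of the affine plane AG(2,q) has size at least 2q−1; that is, any set of affine points meeting every affine line contains at least 2q−1 points. -/
variable {F : Type} [Field F]

theorem exists_basis_aux (F : Type) [Field F] (l : Ln F) (v : Fin 3 → F) (hv : v ∉ l.1) :
    ∃ b : Module.Basis (Fin 3) F (Fin 3 → F), b 0 = v ∧ ∀ x, x ∈ l.1 ↔ b.coord 0 x = 0 := by
  let bl : Module.Basis (Fin 2) F l.1 := Module.finBasisOfFinrankEq F l.1 l.2
  have hli : LinearIndependent F (Fin.cons v (fun i => (bl i : Fin 3 → F)) : Fin 3 → (Fin 3 → F)) := by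
    rw [linearIndependent_finCons]
    refine ⟨?_, ?_⟩
    · exact bl.linearIndependent.map' l.1.subtype (Submodule.ker_subtype _)
    · intro h
      apply hv
      refine (Submodule.span_le.2 ?_) h
      rintro _ ⟨i, rfl⟩
      exact (bl i).2
  let b := basisOfLinearIndependentOfCardEqFinrank hli (by simp)
  have hb : ∀ i, b i = (Fin.cons v (fun i => (bl i : Fin 3 → F)) : Fin 3 → (Fin 3 → F)) i := by
    intro i
    simp [b]
  refine ⟨b, by rw [hb]; rfl, ?_⟩
  have h1 : b 1 ∈ l.1 := by rw [hb]; exact (bl 0).2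
  have h2 : b 2 ∈ l.1 := by rw [hb]; exact (bl 1).2
  have h0 : b 0 = v := by rw [hb]; rfl
  intro x
  have hx := b.sum_repr x
  rw [Fin.sum_univ_three, h0] at hx
  have h12 : (b.repr x 1) • b 1 + (b.repr x 2) • b 2 ∈ l.1 :=
    l.1.add_mem (l.1.smul_mem _ h1) (l.1.smul_mem _ h2)
  rw [Module.Basis.coord_apply]
  constructor
  · intro hxl
    by_contra hne
    apply hv
    have : (b.repr x 0) • v ∈ l.1 := by
      have := l.1.sub_mem hxl h12
      rwa [show x - ((b.repr x 1) • b 1 + (b.repr x 2) • b 2) = (b.repr x 0) • v by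
        nth_rw 1 [← hx]; abel] at this
    exact (l.1.smul_mem_iff hne).1 this
  · intro h
    rw [h, zero_smul, zero_add] at hx
    rwa [hx] at h12

theorem exists_line_aux (F : Type) [Field F] (l : Ln F)
    (b : Module.Basis (Fin 3) F (Fin 3 → F)) (hb : ∀ x, x ∈ l.1 ↔ b.coord 0 x = 0)
    (s : Fin 2 → F) (hs : s ≠ 0) :
    ∃ m : Ln F, m ≠ l ∧ ∀ x, x ∈ m.1 ↔
      b.repr x 0 + b.repr x 1 * s 0 + b.repr x 2 * s 1 = 0 := by
  let f : (Fin 3 → F) →ₗ[F] F := b.coord 0 + s 0 • b.coord 1 + s 1 • b.coord 2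
  have hf : ∀ x, f x = b.repr x 0 + b.repr x 1 * s 0 + b.repr x 2 * s 1 := by
    intro x; simp [f]; ring
  have hf0 : f ≠ 0 := by
    intro h
    have := hf (b 0)
    simp [h] at this
  have hr := Module.Dual.finrank_ker_add_one_of_ne_zero hf0
  refine ⟨⟨LinearMap.ker f, by simpa using hr⟩, ?_, ?_⟩
  · intro h
    apply hs
    have hm : ∀ x, f x = 0 ↔ b.coord 0 x = 0 := by
      intro x
      rw [← hb, ← h]; rfl
    have h1 := (hm (b 1)).2 (by simp)
    have h2 := (hm (b 2)).2 (by simp)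
    rw [hf] at h1 h2
    funext i
    fin_cases i
    · simpa using h1
    · simpa using h2
  · intro x
    rw [← hf]; rfl

/-- (Jamison; Brouwer–Schrijver) Every affine blocking set of AG(2,q) has size at least
`2q - 1`. -/
theorem affBlocking_card_ge
    (F : Type) [Field F] [Fintype F] (l : Ln F)
    (B : Set (Pt F)) (hB : IsAffBlocking l B) :
    2 * Fintype.card F - 1 ≤ B.ncard := by
  classical
  obtain ⟨hA, hL⟩ := hB
  have hfin : Finite (Submodule F (Fin 3 → F)) := Finite.of_injective _ SetLike.coe_injective
  have hBf : B.Finite := Set.toFinite B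
  have hex : ∃ v : Fin 3 → F, v ∉ l.1 := by
    by_contra! h
    have : l.1 = ⊤ := by ext x; simp [h x]
    have h2 := l.2
    rw [this] at h2
    simp at h2
  obtain ⟨P₀, hP₀⟩ : ∃ P, P ∈ B := by
    obtain ⟨v, hv⟩ := hex
    obtain ⟨b, -, hb⟩ := exists_basis_aux F l v hv
    obtain ⟨m, hm, -⟩ := exists_line_aux F l b hb (fun _ => 1) (fun h => by
      simpa using congrFun h 0)
    obtain ⟨P, hP, -⟩ := hL m hm
    exact ⟨P, hP⟩
  have hA' : ∀ P : Pt F, ∃ v : Fin 3 → F, v ∈ P.1 ∧ (P ∈ B → v ∉ l.1) := by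
    intro P
    by_cases hP : P ∈ B
    · obtain ⟨v, h1, h2⟩ := SetLike.not_le_iff_exists.1 (hA P hP)
      exact ⟨v, h1, fun _ => h2⟩
    · exact ⟨0, P.1.zero_mem, fun h => absurd h hP⟩
  choose w hwP hwl using hA'
  obtain ⟨b, hb0, hb⟩ := exists_basis_aux F l (w P₀) (hwl P₀ hP₀)
  let T : Finset (Pt F) := hBf.toFinset.erase P₀
  let g : Pt F → MvPolynomial (Fin 2) F := fun P =>
    MvPolynomial.C (b.repr (w P) 0) + MvPolynomial.C (b.repr (w P) 1) * MvPolynomial.X 0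
      + MvPolynomial.C (b.repr (w P) 2) * MvPolynomial.X 1
  have hg : ∀ P, (g P).totalDegree ≤ 1 := by
    intro P
    refine (MvPolynomial.totalDegree_add _ _).trans (max_le ?_ ?_)
    · refine (MvPolynomial.totalDegree_add _ _).trans (max_le (by simp) ?_)
      exact (MvPolynomial.totalDegree_mul _ _).trans (by simp)
    · exact (MvPolynomial.totalDegree_mul _ _).trans (by simp)
  have hev : ∀ P s, MvPolynomial.eval s (g P) =
      b.repr (w P) 0 + b.repr (w P) 1 * s 0 + b.repr (w P) 2 * s 1 := by
    intro P s; simp [g]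
  have hdeg : (∏ P ∈ T, g P).totalDegree ≤ T.card := by
    refine (MvPolynomial.totalDegree_finset_prod _ _).trans ?_
    exact (Finset.sum_le_card_nsmul _ _ 1 (fun P _ => hg P)).trans (by simp)
  have hcard : T.card + 1 = B.ncard := by
    rw [Set.ncard_eq_toFinset_card B hBf]
    exact Finset.card_erase_add_one (by simpa using hP₀)
  by_contra hlt
  have hq : 1 < Fintype.card F := Fintype.one_lt_card
  have hsum := MvPolynomial.sum_eval_eq_zero (∏ P ∈ T, g P) (by
    rw [Fintype.card_fin]; omega)
  rw [Finset.sum_eq_single 0] at hsum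
  · rw [map_prod, Finset.prod_eq_zero_iff] at hsum
    obtain ⟨P, hP, h⟩ := hsum
    rw [hev] at h
    have hPB : P ∈ B := by simpa using Finset.mem_of_mem_erase hP
    apply hwl P hPB
    rw [hb]
    simpa using h
  · intro s _ hs
    obtain ⟨m, hm, hmx⟩ := exists_line_aux F l b hb s hs
    obtain ⟨P, hP, hPm⟩ := hL m hm
    have h := (hmx (w P)).1 (hPm (hwP P))
    rw [map_prod]
    refine Finset.prod_eq_zero (i := P) ?_ (by rw [hev, h])
    refine Finset.mem_erase.2 ⟨?_, by simpa using hP⟩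
    rintro rfl
    rw [← hb0] at h
    simp at h
  · simp
end
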